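/- Let X be a separable infinite-dimensional real Banach space with norm ‖·‖, let C ⊆ X be countable and dense, let (p_c)_{c∈C} be positive reals with Σ_{c∈C} p_c(1 + ‖c‖) < ∞, and let |||x||| := Σ_{c∈C} p_c ( ‖c‖x‖ + x‖ + ‖c‖x‖ − x‖ ) be the asymptotic norm generated by ‖·‖. If there exists a basic array (x_i^n)_{n,i∈ω} in X, each of whose rows is weakly null, which generates in (X, |||·|||) an asymptotic model (e_i)_{i∈ω} that is 1-equivalent to the unit vector basis of c₀, then X contains a subspace isomorphic to c₀. -/

import Mathlib

open Filter Finset Topology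

variable {X : Type*} [NormedAddCommGroup X] [NormedSpace ℝ X]
variable {E : Type*} [NormedAddCommGroup E] [NormedSpace ℝ E]

/-- `(x i)` is a `C`-basic sequence. -/
def IsCBasic (C : ℝ) (x : ℕ → X) : Prop :=
  (∀ i, x i ≠ 0) ∧
    ∀ n m : ℕ, n < m → ∀ a : ℕ → ℝ,
      ‖∑ i ∈ Finset.range n, a i • x i‖ ≤ C * ‖∑ i ∈ Finset.range m, a i • x i‖

/-- The finite sequence `y 0, …, y (m-1)` is `C`-basic. -/
def IsCBasicUpTo (C : ℝ) (m : ℕ) (y : ℕ → X) : Prop :=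
  (∀ j, j < m → y j ≠ 0) ∧
    ∀ n k : ℕ, n < k → k ≤ m → ∀ a : ℕ → ℝ,
      ‖∑ i ∈ Finset.range n, a i • y i‖ ≤ C * ‖∑ i ∈ Finset.range k, a i • y i‖

/-- `(x i)` is normalized. -/
def Normalized (x : ℕ → X) : Prop := ∀ i, ‖x i‖ = 1

/-- `x` is a `K`-basic array: each row `x n` is a normalized `K`-basic sequence and every
"diagonal" sequence `(x j (i j))_{j<m}` with `m ≤ i 0 < i 1 < ⋯` is `K`-basic. -/
def IsBasicArrayWith (K : ℝ) (x : ℕ → ℕ → X) : Prop :=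
  (∀ n, Normalized (x n) ∧ IsCBasic K (x n)) ∧
    ∀ (m : ℕ) (i : ℕ → ℕ), StrictMono i → m ≤ i 0 →
      IsCBasicUpTo K m fun j => x j (i j)

/-- `x` is a basic array if it is a `K`-basic array for some `K`. -/
def IsBasicArray (x : ℕ → ℕ → X) : Prop := ∃ K : ℝ, IsBasicArrayWith K x

/-- `IteratedLimit n f L`: the iterated limit `lim_{i₀→∞} ⋯ lim_{i_{n-1}→∞} f (i₀, …, i_{n-1})`
exists and equals `L`. -/
def IteratedLimit : ∀ n : ℕ, ((Fin n → ℕ) → ℝ) → ℝ → Prop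
  | 0, f, L => f (fun i => i.elim0) = L
  | n + 1, f, L => ∃ g : ℕ → ℝ,
      (∀ i₀ : ℕ, IteratedLimit n (fun t => f (Fin.cons i₀ t)) (g i₀)) ∧
      Filter.Tendsto g Filter.atTop (nhds L)

/-- `(x i)` is a `C`-basic sequence with respect to the norm function `ν`. -/
def IsCBasicW (ν : X → ℝ) (C : ℝ) (x : ℕ → X) : Prop :=
  (∀ i, x i ≠ 0) ∧
    ∀ n m : ℕ, n < m → ∀ a : ℕ → ℝ,
      ν (∑ i ∈ Finset.range n, a i • x i) ≤ C * ν (∑ i ∈ Finset.range m, a i • x i)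

/-- The finite sequence `y 0, …, y (m-1)` is `C`-basic with respect to `ν`. -/
def IsCBasicUpToW (ν : X → ℝ) (C : ℝ) (m : ℕ) (y : ℕ → X) : Prop :=
  (∀ j, j < m → y j ≠ 0) ∧
    ∀ n k : ℕ, n < k → k ≤ m → ∀ a : ℕ → ℝ,
      ν (∑ i ∈ Finset.range n, a i • y i) ≤ C * ν (∑ i ∈ Finset.range k, a i • y i)

/-- `(x i)` is normalized with respect to `ν`. -/
def NormalizedW (ν : X → ℝ) (x : ℕ → X) : Prop := ∀ i, ν (x i) = 1

/-- `x` is a `K`-basic array with respect to `ν`. -/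
def IsBasicArrayWithW (ν : X → ℝ) (K : ℝ) (x : ℕ → ℕ → X) : Prop :=
  (∀ n, NormalizedW ν (x n) ∧ IsCBasicW ν K (x n)) ∧
    ∀ (m : ℕ) (i : ℕ → ℕ), StrictMono i → m ≤ i 0 →
      IsCBasicUpToW ν K m fun j => x j (i j)

/-- `x` is a basic array with respect to `ν`. -/
def IsBasicArrayW (ν : X → ℝ) (x : ℕ → ℕ → X) : Prop := ∃ K : ℝ, IsBasicArrayWithW ν K x

/-- `IterLim2 F L`: the iterated limit `lim_{m→∞} lim_{n→∞} F m n` exists and equals `L`. -/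
def IterLim2 (F : ℕ → ℕ → ℝ) (L : ℝ) : Prop :=
  ∃ g : ℕ → ℝ, (∀ m, Filter.Tendsto (fun n => F m n) Filter.atTop (nhds (g m))) ∧
    Filter.Tendsto g Filter.atTop (nhds L)

/-- The norm `‖x‖_c = ‖c‖x‖ + x‖ + ‖c‖x‖ - x‖` summed with weights `p c` over the countable
dense set `C`: the asymptotic norm `|||·|||` generated by `‖·‖`. -/
noncomputable def tripNorm (C : Set X) (p : X → ℝ) (x : X) : ℝ :=
  ∑' c : C, p (c : X) * (‖‖x‖ • (c : X) + x‖ + ‖‖x‖ • (c : X) - x‖)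

/-- `(x i)` is weakly null. -/
def WeaklyNull (x : ℕ → X) : Prop :=
  ∀ f : X →L[ℝ] ℝ, Filter.Tendsto (fun i => f (x i)) Filter.atTop (nhds 0)

section FiniteSup

theorem bddAbove_biSup_abs (n : ℕ) (a : ℕ → ℝ) :
    BddAbove (Set.range fun i => ⨆ _ : i ∈ Finset.range n, |a i|) := by
  refine ⟨∑ j ∈ Finset.range n, |a j|, ?_⟩
  rintro _ ⟨i, rfl⟩
  refine Real.iSup_le (fun hi => ?_) (Finset.sum_nonneg fun _ _ => abs_nonneg _)
  exact Finset.single_le_sum (f := fun j => |a j|) (fun _ _ => abs_nonneg _) hi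

theorem abs_le_biSup_abs {n i : ℕ} (a : ℕ → ℝ) (hi : i < n) :
    |a i| ≤ ⨆ j ∈ Finset.range n, |a j| := by
  refine le_trans ?_ (le_ciSup (bddAbove_biSup_abs n a) i)
  simp [hi]

theorem biSup_abs_le {n : ℕ} (a : ℕ → ℝ) {c : ℝ} (hc : 0 ≤ c) (h : ∀ i < n, |a i| ≤ c) :
    (⨆ j ∈ Finset.range n, |a j|) ≤ c :=
  Real.iSup_le (fun i => Real.iSup_le (fun hi => h i (Finset.mem_range.1 hi)) hc) hc

theorem biSup_abs_nonneg (n : ℕ) (a : ℕ → ℝ) : 0 ≤ ⨆ j ∈ Finset.range n, |a j| :=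
  Real.iSup_nonneg fun _ => Real.iSup_nonneg fun _ => abs_nonneg _

end FiniteSup

section AsymptoticNorm

/-- The summand `‖x‖_c` of the asymptotic norm. -/
noncomputable def pairNorm (c x : X) : ℝ := ‖‖x‖ • c + x‖ + ‖‖x‖ • c - x‖

theorem pairNorm_neg (c x : X) : pairNorm c (-x) = pairNorm c x := by
  simp only [pairNorm, norm_neg, sub_neg_eq_add, ← sub_eq_add_neg]
  exact add_comm _ _

theorem tripNorm_neg (C : Set X) (p : X → ℝ) (x : X) : tripNorm C p (-x) = tripNorm C p x :=
  tsum_congr fun c => congrArg (p c * ·) (pairNorm_neg (c : X) x)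

theorem two_mul_norm_le_add_sub (u v : X) : 2 * ‖u‖ ≤ ‖u + v‖ + ‖u - v‖ := by
  have h := norm_add_le (u + v) (u - v)
  rwa [show u + v + (u - v) = (2 : ℝ) • u by rw [two_smul]; abel, norm_smul, Real.norm_ofNat] at h

theorem two_mul_norm_le_pairNorm (c x : X) : 2 * ‖x‖ ≤ pairNorm c x := by
  have h := two_mul_norm_le_add_sub x (‖x‖ • c)
  rwa [norm_sub_rev, add_comm x] at h

theorem two_mul_norm_mul_norm_le_pairNorm (c x : X) : 2 * (‖x‖ * ‖c‖) ≤ pairNorm c x := by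
  have h := two_mul_norm_le_add_sub (‖x‖ • c) x
  rwa [norm_smul, norm_norm] at h

theorem pairNorm_le (c x : X) : pairNorm c x ≤ 2 * (‖x‖ * (1 + ‖c‖)) := by
  have h1 := norm_add_le (‖x‖ • c) x
  have h2 := norm_sub_le (‖x‖ • c) x
  rw [norm_smul, norm_norm] at h1 h2
  unfold pairNorm
  linarith

/-- `τ ↦ ‖τ c + x‖ + ‖τ c - x‖` is monotone on `[0, ∞)`. -/
theorem norm_smul_add_add_norm_smul_sub_mono (c x : X) {r s : ℝ} (hr : 0 ≤ r) (hrs : r ≤ s) :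
    ‖r • c + x‖ + ‖r • c - x‖ ≤ ‖s • c + x‖ + ‖s • c - x‖ := by
  rcases (hr.trans hrs).eq_or_lt with h0 | h0
  · rw [show r = s by linarith]
  set l := r / s with hl
  have hl0 : 0 ≤ l := div_nonneg hr h0.le
  have hl1 : l ≤ 1 := (div_le_one h0).2 hrs
  have hrl : r = l * s := by rw [hl]; field_simp
  have e1 : r • c + x = ((1 + l) / 2) • (s • c + x) - ((1 - l) / 2) • (s • c - x) := by
    rw [hrl]; module
  have e2 : r • c - x = ((1 + l) / 2) • (s • c - x) - ((1 - l) / 2) • (s • c + x) := by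
    rw [hrl]; module
  have n1 := norm_sub_le (((1 + l) / 2) • (s • c + x)) (((1 - l) / 2) • (s • c - x))
  have n2 := norm_sub_le (((1 + l) / 2) • (s • c - x)) (((1 - l) / 2) • (s • c + x))
  rw [← e1] at n1
  rw [← e2] at n2
  simp only [norm_smul, Real.norm_eq_abs] at n1 n2
  rw [abs_of_nonneg (by linarith : 0 ≤ (1 + l) / 2),
    abs_of_nonneg (by linarith : 0 ≤ (1 - l) / 2)] at n1 n2
  linarith

theorem two_mul_pairNorm_le (c u v : X) :
    2 * pairNorm c u ≤ pairNorm c (u + v) + pairNorm c (u - v) := by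
  unfold pairNorm
  set s := ‖u + v‖
  set t := ‖u - v‖
  have hst : ‖u‖ ≤ (s + t) / 2 := by linarith [two_mul_norm_le_add_sub u v]
  have h := norm_smul_add_add_norm_smul_sub_mono c u (norm_nonneg u) hst
  have h1 := norm_add_le (s • c + (u + v)) (t • c + (u - v))
  have h2 := norm_add_le (s • c - (u + v)) (t • c - (u - v))
  rw [show s • c + (u + v) + (t • c + (u - v)) = (2 : ℝ) • (((s + t) / 2) • c + u) by module,
    norm_smul, Real.norm_ofNat] at h1
  rw [show s • c - (u + v) + (t • c - (u - v)) = (2 : ℝ) • (((s + t) / 2) • c - u) by module,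
    norm_smul, Real.norm_ofNat] at h2
  linarith

variable {C : Set X} {p : X → ℝ}

theorem summable_mul_pairNorm (hp : ∀ c ∈ C, 0 < p c)
    (hsum : Summable fun c : C => p (c : X) * (1 + ‖(c : X)‖)) (x : X) :
    Summable fun c : C => p (c : X) * pairNorm (c : X) x := by
  refine Summable.of_nonneg_of_le (fun c => ?_) (fun c => ?_) (hsum.mul_left (2 * ‖x‖))
  · have := two_mul_norm_le_pairNorm (c : X) x
    exact mul_nonneg (hp c c.2).le (by linarith [norm_nonneg x])
  · have := mul_le_mul_of_nonneg_left (pairNorm_le (c : X) x) (hp c c.2).le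
    linarith

theorem tripNorm_le (hp : ∀ c ∈ C, 0 < p c)
    (hsum : Summable fun c : C => p (c : X) * (1 + ‖(c : X)‖)) (x : X) :
    tripNorm C p x ≤ 2 * (∑' c : C, p (c : X) * (1 + ‖(c : X)‖)) * ‖x‖ := by
  rw [mul_right_comm, ← tsum_mul_left]
  refine (summable_mul_pairNorm hp hsum x).tsum_le_tsum (fun c => ?_) (hsum.mul_left _)
  have := mul_le_mul_of_nonneg_left (pairNorm_le (c : X) x) (hp c c.2).le
  change p (c : X) * pairNorm (c : X) x ≤ _
  linarith

theorem mul_norm_le_tripNorm (hp : ∀ c ∈ C, 0 < p c)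
    (hsum : Summable fun c : C => p (c : X) * (1 + ‖(c : X)‖)) {c : X} (hc : c ∈ C) (x : X) :
    2 * p c * ‖x‖ ≤ tripNorm C p x := by
  have h := (summable_mul_pairNorm hp hsum x).le_tsum ⟨c, hc⟩ fun d _ =>
    mul_nonneg (hp d d.2).le (by linarith [two_mul_norm_le_pairNorm (d : X) x, norm_nonneg x])
  have := mul_le_mul_of_nonneg_left (two_mul_norm_le_pairNorm c x) (hp c hc).le
  refine le_trans ?_ h
  simp only
  linarith

theorem mul_pairNorm_sub_le (hp : ∀ c ∈ C, 0 < p c)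
    (hsum : Summable fun c : C => p (c : X) * (1 + ‖(c : X)‖)) {c : X} (hc : c ∈ C) (u v : X) :
    p c * (pairNorm c (u + v) + pairNorm c (u - v) - 2 * pairNorm c u) ≤
      tripNorm C p (u + v) + tripNorm C p (u - v) - 2 * tripNorm C p u := by
  have s1 := (summable_mul_pairNorm hp hsum (u + v)).hasSum
  have s2 := (summable_mul_pairNorm hp hsum (u - v)).hasSum
  have s3 := (summable_mul_pairNorm hp hsum u).hasSum.mul_left 2
  have s := (s1.add s2).sub s3
  have h := le_hasSum s ⟨c, hc⟩ fun d _ => by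
    have := mul_nonneg (hp d d.2).le (sub_nonneg.2 (two_mul_pairNorm_le (d : X) u v))
    linarith
  refine le_trans (le_of_eq ?_) h
  simp only
  ring

end AsymptoticNorm

section Limits

theorem exists_tendsto_of_bounded {ι : Type*} (U : Ultrafilter ι) (h : ι → ℝ) (M : ℝ)
    (hM : ∀ i, |h i| ≤ M) : ∃ l, Tendsto h U (𝓝 l) := by
  obtain ⟨l, -, hl⟩ := (isCompact_Icc (a := -M) (b := M)).ultrafilter_le_nhds (U.map h) (by
    rw [le_principal_iff]
    exact Filter.mem_map.2 (Filter.univ_mem' fun i => abs_le.1 (hM i)))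
  exact ⟨l, hl⟩

theorem tendsto_curry_of_tendsto {ι κ : Type*} {F : Filter ι} {G : Filter κ} {h : ι → κ → ℝ}
    {g : ι → ℝ} {l : ℝ} (hg : ∀ i, Tendsto (h i) G (𝓝 (g i))) (hl : Tendsto g F (𝓝 l)) :
    Tendsto (fun q : ι × κ => h q.1 q.2) (F.curry G) (𝓝 l) := by
  rw [Metric.tendsto_nhds]
  intro ε hε
  rw [Filter.eventually_curry_iff]
  filter_upwards [Metric.tendsto_nhds.1 hl (ε / 2) (by positivity)] with i hi
  filter_upwards [Metric.tendsto_nhds.1 (hg i) (ε / 2) (by positivity)] with j hj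
  linarith [dist_triangle (h i j) (g i) l]

theorem IteratedLimit.tendsto_curry {f : (Fin 2 → ℕ) → ℝ} {L : ℝ} (h : IteratedLimit 2 f L)
    {U : Filter ℕ} (hU : U ≤ atTop) :
    Tendsto (fun q : ℕ × ℕ => f ![q.1, q.2]) (U.curry U) (𝓝 L) := by
  obtain ⟨g, hg, hL⟩ := h
  refine tendsto_curry_of_tendsto (h := fun i j => f ![i, j]) (fun i => ?_) (hL.mono_left hU)
  obtain ⟨g', hg', hL'⟩ := hg i
  refine Tendsto.congr (fun j => ?_) (hL'.mono_left hU)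
  rw [← hg' j]
  congr 1

/-- A continuous convex function is weakly sequentially lower semicontinuous. -/
theorem ConvexOn.le_of_tendsto_of_weaklyNull {g : X → ℝ} (hconv : ConvexOn ℝ Set.univ g)
    (hcont : Continuous g) {z : ℕ → X} (hz : WeaklyNull z) {U : Filter ℕ} [U.NeBot]
    (hU : U ≤ atTop) {y : X} {l : ℝ} (hl : Tendsto (fun i => g (y + z i)) U (𝓝 l)) :
    g y ≤ l := by
  by_contra! hlt
  obtain ⟨m, hlm, hmy⟩ := exists_between hlt
  obtain ⟨f, r, hfr, hry⟩ := geometric_hahn_banach_closed_point (s := {w | g w ≤ m}) (x := y)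
    (by simpa using hconv.convex_le m) (isClosed_le hcont continuous_const) (by simpa using hmy)
  have hf : Tendsto (fun i => f (y + z i)) U (𝓝 (f y)) := by
    simpa using ((hz f).mono_left hU).const_add (f y)
  have : f y ≤ r := le_of_tendsto hf (by
    filter_upwards [hl.eventually_lt_const hlm] with i hi using (hfr _ hi.le).le)
  linarith

theorem le_of_tendsto_norm_add_of_weaklyNull {z : ℕ → X} (hz : WeaklyNull z) {U : Filter ℕ}
    [U.NeBot] (hU : U ≤ atTop) {y : X} {l : ℝ}
    (hl : Tendsto (fun i => ‖y + z i‖) U (𝓝 l)) : ‖y‖ ≤ l :=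
  ConvexOn.le_of_tendsto_of_weaklyNull convexOn_univ_norm continuous_norm hz hU hl

section LimitFunction

variable {ι : Type*} {U : Filter ι} [U.NeBot] {z : ι → X} {g : X → ℝ}

theorem convexOn_of_tendsto_norm_add (hg : ∀ y, Tendsto (fun i => ‖y + z i‖) U (𝓝 (g y))) :
    ConvexOn ℝ Set.univ g := by
  refine ⟨convex_univ, fun v _ w _ a b ha hb hab => ?_⟩
  refine le_of_tendsto_of_tendsto' (hg _) (((hg v).const_mul a).add ((hg w).const_mul b))
    fun i => ?_
  have e : a • v + b • w + z i = a • (v + z i) + b • (w + z i) := by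
    rw [smul_add, smul_add, add_add_add_comm, ← add_smul, hab, one_smul]
  rw [e]
  refine (norm_add_le _ _).trans_eq ?_
  rw [norm_smul, norm_smul, Real.norm_of_nonneg ha, Real.norm_of_nonneg hb]

theorem continuous_of_tendsto_norm_add {X : Type*} [NormedAddCommGroup X] {z : ι → X}
    {g : X → ℝ} (hg : ∀ y, Tendsto (fun i => ‖y + z i‖) U (𝓝 (g y))) :
    Continuous g := by
  refine (LipschitzWith.of_le_add fun v w => ?_).continuous
  refine le_of_tendsto_of_tendsto' (hg v) ((hg w).add_const _) fun i => ?_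
  have := norm_add_le (w + z i) (v - w)
  rw [dist_eq_norm]
  rwa [show w + z i + (v - w) = v + z i by abel] at this

end LimitFunction

end Limits

section Stabilization

/-- The symmetrized norm `‖y + w‖ + ‖y - w‖`. -/
noncomputable def symNorm {X : Type*} [NormedAddCommGroup X] (y w : X) : ℝ := ‖y + w‖ + ‖y - w‖

theorem abs_symNorm_sub_le {X : Type*} [NormedAddCommGroup X] (a b w : X) : |symNorm a w - symNorm b w| ≤ 2 * ‖a - b‖ := by
  have h1 := abs_norm_sub_norm_le (a + w) (b + w)
  have h2 := abs_norm_sub_norm_le (a - w) (b - w)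
  rw [add_sub_add_right_eq_sub] at h1
  rw [sub_sub_sub_cancel_right] at h2
  unfold symNorm
  rw [abs_le] at *
  constructor <;> linarith

variable {C : Set X} {p : X → ℝ} {ι : Type*} {W : Filter ι} {u v : ι → X}

theorem tendsto_pairNorm_defect (hp : ∀ c ∈ C, 0 < p c)
    (hsum : Summable fun c : C => p (c : X) * (1 + ‖(c : X)‖))
    (hadd : Tendsto (fun i => tripNorm C p (u i + v i)) W (𝓝 1))
    (hsub : Tendsto (fun i => tripNorm C p (u i - v i)) W (𝓝 1))
    (hu : ∀ i, tripNorm C p (u i) = 1) {c : X} (hc : c ∈ C) :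
    Tendsto (fun i => pairNorm c (u i + v i) + pairNorm c (u i - v i) - 2 * pairNorm c (u i))
      W (𝓝 0) := by
  have h : Tendsto (fun i => (tripNorm C p (u i + v i) + tripNorm C p (u i - v i)
      - 2 * tripNorm C p (u i)) / p c) W (𝓝 0) := by
    have := (((hadd.add hsub).sub_const 2).div_const (p c))
    norm_num at this
    simpa [hu] using this
  refine squeeze_zero (fun i => ?_) (fun i => ?_) h
  · linarith [two_mul_pairNorm_le c (u i) (v i)]
  · rw [le_div_iff₀ (hp c hc), mul_comm]
    exact mul_pairNorm_sub_le hp hsum hc _ _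

theorem add_le_two_mul_of_tendsto_norm [Nontrivial X] [W.NeBot] (hCd : Dense C)
    (hp : ∀ c ∈ C, 0 < p c)
    (hsum : Summable fun c : C => p (c : X) * (1 + ‖(c : X)‖))
    (hadd : Tendsto (fun i => tripNorm C p (u i + v i)) W (𝓝 1))
    (hsub : Tendsto (fun i => tripNorm C p (u i - v i)) W (𝓝 1))
    (hu : ∀ i, tripNorm C p (u i) = 1) {R S T : ℝ}
    (hR : Tendsto (fun i => ‖u i‖) W (𝓝 R)) (hS : Tendsto (fun i => ‖u i + v i‖) W (𝓝 S))
    (hT : Tendsto (fun i => ‖u i - v i‖) W (𝓝 T)) : S + T ≤ 2 * R := by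
  by_contra! hlt
  have hpos : 0 < S + T - 2 * R := by linarith
  obtain ⟨x₀, hx₀⟩ := NormedSpace.exists_lt_norm ℝ X (2 * R / (S + T - 2 * R))
  obtain ⟨c, hcM, hcC⟩ := hCd.inter_open_nonempty {z | 2 * R / (S + T - 2 * R) < ‖z‖}
    (isOpen_lt continuous_const continuous_norm) ⟨x₀, hx₀⟩
  have h := le_of_tendsto_of_tendsto'
    (((hS.add hT).mul_const (2 * ‖c‖)).sub (hR.mul_const (4 * (1 + ‖c‖))))
    (tendsto_pairNorm_defect hp hsum hadd hsub hu hcC) fun i => by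
      linarith [two_mul_norm_mul_norm_le_pairNorm c (u i + v i),
        two_mul_norm_mul_norm_le_pairNorm c (u i - v i), pairNorm_le c (u i)]
  have h2 := (div_lt_iff₀ hpos).1 hcM
  linarith

theorem tendsto_symNorm_defect (hCd : Dense C) (hp : ∀ c ∈ C, 0 < p c)
    (hsum : Summable fun c : C => p (c : X) * (1 + ‖(c : X)‖))
    (hadd : Tendsto (fun i => tripNorm C p (u i + v i)) W (𝓝 1))
    (hsub : Tendsto (fun i => tripNorm C p (u i - v i)) W (𝓝 1))
    (hu : ∀ i, tripNorm C p (u i) = 1) {L : ℝ} (hL : 0 < L)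
    (hR : Tendsto (fun i => ‖u i‖) W (𝓝 L)) (hS : Tendsto (fun i => ‖u i + v i‖) W (𝓝 L))
    (hT : Tendsto (fun i => ‖u i - v i‖) W (𝓝 L)) (y : X) :
    Tendsto (fun i => symNorm y (u i + v i) + symNorm y (u i - v i) - 2 * symNorm y (u i))
      W (𝓝 0) := by
  rw [Metric.tendsto_nhds]
  intro ε hε
  obtain ⟨c, hcC, hc⟩ := Metric.dense_iff.1 hCd (L⁻¹ • y) (ε / (16 * L)) (by positivity)
    |>.imp fun _ h => h.symm
  have hyc : ‖y - L • c‖ < ε / 16 := by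
    rw [Metric.mem_ball', dist_eq_norm, lt_div_iff₀ (by positivity)] at hc
    have : y - L • c = L • (L⁻¹ • y - c) := by
      rw [smul_sub, smul_smul, mul_inv_cancel₀ hL.ne', one_smul]
    rw [this, norm_smul, Real.norm_of_nonneg hL.le]
    linarith
  have hlim {r : ι → ℝ} (hr : Tendsto r W (𝓝 L)) :
      Tendsto (fun i => ‖y - r i • c‖) W (𝓝 ‖y - L • c‖) :=
    (tendsto_const_nhds.sub (hr.smul_const c)).norm
  have hD := tendsto_pairNorm_defect hp hsum hadd hsub hu hcC
  filter_upwards [Metric.tendsto_nhds.1 hD (ε / 2) (by positivity),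
    (hlim hR).eventually_lt_const hyc, (hlim hS).eventually_lt_const hyc,
    (hlim hT).eventually_lt_const hyc] with i hi hr hs ht
  have e1 := abs_symNorm_sub_le y (‖u i‖ • c) (u i)
  have e2 := abs_symNorm_sub_le y (‖u i + v i‖ • c) (u i + v i)
  have e3 := abs_symNorm_sub_le y (‖u i - v i‖ • c) (u i - v i)
  rw [Real.dist_0_eq_abs, abs_lt] at *
  simp only [pairNorm] at hi
  simp only [symNorm] at *
  rw [abs_le] at e1 e2 e3
  constructor <;> linarith

/-- Two weakly null sequences whose asymptotic model for the asymptotic norm is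
`1`-equivalent to the basis of `ℓ_∞²` generate an even type `A` that is invariant under
translation by the first sequence in the limit. -/
theorem exists_invariant_type [Nontrivial X] (hCd : Dense C) (hp : ∀ c ∈ C, 0 < p c)
    (hsum : Summable fun c : C => p (c : X) * (1 + ‖(c : X)‖)) {x x' : ℕ → X}
    (hx : WeaklyNull x) (hx' : WeaklyNull x') (hx1 : ∀ i, tripNorm C p (x i) = 1)
    (hx1' : ∀ i, tripNorm C p (x' i) = 1) {U : Ultrafilter ℕ} (hU : (U : Filter ℕ) ≤ atTop)
    (hadd : Tendsto (fun q : ℕ × ℕ => tripNorm C p (x q.1 + x' q.2))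
      ((U : Filter ℕ).curry U) (𝓝 1))
    (hsub : Tendsto (fun q : ℕ × ℕ => tripNorm C p (x q.1 - x' q.2))
      ((U : Filter ℕ).curry U) (𝓝 1)) :
    ∃ A : X → ℝ, (∀ y, Tendsto (fun i => ‖y + x i‖) U (𝓝 (A y))) ∧
      (∀ y, Tendsto (fun i => A (y + x i)) U (𝓝 (A y))) ∧ ∀ y, A (-y) = A y := by
  have : ((U : Filter ℕ).curry (U : Filter ℕ)).NeBot := ⟨fun h => by
    have h' := mem_curry_iff.1 (empty_mem_iff_bot.2 h)
    exact U.neBot.ne (by simpa using h')⟩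
  obtain ⟨c₀, hc₀⟩ := hCd.nonempty
  have hpc : 0 < 2 * p c₀ := by linarith [hp c₀ hc₀]
  set M := 1 / (2 * p c₀) with hM
  have hbd {z : X} (hz : tripNorm C p z = 1) : ‖z‖ ≤ M := by
    rw [hM, le_div_iff₀ hpc, ← hz, mul_comm]
    exact mul_norm_le_tripNorm hp hsum hc₀ z
  have hex {z : ℕ → X} (hz : ∀ i, tripNorm C p (z i) = 1) (y : X) :
      ∃ l, Tendsto (fun i => ‖y + z i‖) U (𝓝 l) :=
    exists_tendsto_of_bounded U _ (‖y‖ + M) fun i => by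
      rw [abs_norm]
      exact (norm_add_le _ _).trans (by linarith [hbd (hz i)])
  choose A hA using hex hx1
  choose B hB using hex hx1'
  have hBbd (y : X) : |B y| ≤ ‖y‖ + M := by
    rw [abs_of_nonneg (ge_of_tendsto' (hB y) fun i => norm_nonneg _)]
    exact le_of_tendsto' (hB y) fun i => (norm_add_le _ _).trans (by linarith [hbd (hx1' i)])
  have hexB {z : ℕ → X} (hz : ∀ i, ‖z i‖ ≤ M) (y : X) :
      ∃ l, Tendsto (fun i => B (y + z i)) U (𝓝 l) :=
    exists_tendsto_of_bounded U _ (‖y‖ + M + M) fun i =>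
      (hBbd _).trans (by linarith [norm_add_le y (z i), hz i])
  choose S hS using hexB fun i => hbd (hx1 i)
  choose S' hS' using hexB (z := fun i => -x i) fun i => by rw [norm_neg]; exact hbd (hx1 i)
  have hxn : WeaklyNull fun i => -x i := fun f => by simpa using (hx f).neg
  have hconv := convexOn_of_tendsto_norm_add hB
  have hcont := continuous_of_tendsto_norm_add hB
  have hAn (y : X) : Tendsto (fun i => ‖y - x i‖) U (𝓝 (A (-y))) :=
    (hA (-y)).congr fun i => by rw [← norm_neg]; congr 1; abel
  have hBn (y : X) : Tendsto (fun i => ‖y - x' i‖) U (𝓝 (B (-y))) :=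
    (hB (-y)).congr fun i => by rw [← norm_neg]; congr 1; abel
  have wA (y : X) : Tendsto (fun q : ℕ × ℕ => ‖y + x q.1‖) ((U : Filter ℕ).curry U) (𝓝 (A y)) :=
    tendsto_curry_of_tendsto (h := fun i _ => ‖y + x i‖) (fun _ => tendsto_const_nhds) (hA y)
  have wB (y : X) : Tendsto (fun q : ℕ × ℕ => ‖y + x' q.2‖) ((U : Filter ℕ).curry U) (𝓝 (B y)) :=
    tendsto_curry_of_tendsto (h := fun _ j => ‖y + x' j‖) (fun _ => hB y) tendsto_const_nhds
  have wAs (y : X) : Tendsto (fun q : ℕ × ℕ => symNorm y (x q.1))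
      ((U : Filter ℕ).curry U) (𝓝 (A y + A (-y))) :=
    (wA y).add (tendsto_curry_of_tendsto (h := fun i _ => ‖y - x i‖)
      (fun _ => tendsto_const_nhds) (hAn y))
  have wBs (y : X) : Tendsto (fun q : ℕ × ℕ => symNorm y (x' q.2))
      ((U : Filter ℕ).curry U) (𝓝 (B y + B (-y))) :=
    (wB y).add (tendsto_curry_of_tendsto (h := fun _ j => ‖y - x' j‖)
      (fun _ => hBn y) tendsto_const_nhds)
  have wS (y : X) : Tendsto (fun q : ℕ × ℕ => ‖y + x q.1 + x' q.2‖)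
      ((U : Filter ℕ).curry U) (𝓝 (S y)) :=
    tendsto_curry_of_tendsto (h := fun i j => ‖y + x i + x' j‖) (fun _ => hB _) (hS y)
  have wS' (y : X) : Tendsto (fun q : ℕ × ℕ => ‖y + -x q.1 + x' q.2‖)
      ((U : Filter ℕ).curry U) (𝓝 (S' y)) :=
    tendsto_curry_of_tendsto (h := fun i j => ‖y + -x i + x' j‖) (fun _ => hB _) (hS' y)
  have hSA (y : X) : A y ≤ S y := le_of_tendsto_of_tendsto' (hA y) (hS y) fun i =>
    le_of_tendsto_norm_add_of_weaklyNull hx' hU (hB _)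
  have hSA' (y : X) : A (-y) ≤ S' y := le_of_tendsto_of_tendsto' (hAn y) (hS' y) fun i => by
    rw [sub_eq_add_neg]
    exact le_of_tendsto_norm_add_of_weaklyNull hx' hU (hB _)
  have hSB (y : X) : B y ≤ S y := hconv.le_of_tendsto_of_weaklyNull hcont hx hU (hS y)
  have hSB' (y : X) : B y ≤ S' y := hconv.le_of_tendsto_of_weaklyNull hcont hxn hU (hS' y)
  have wadd (y : X) : Tendsto (fun q : ℕ × ℕ => symNorm y (x q.1 + x' q.2))
      ((U : Filter ℕ).curry U) (𝓝 (S y + S (-y))) :=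
    ((wS y).add (wS (-y))).congr fun q => by
      unfold symNorm
      rw [← norm_neg (-y + x q.1 + x' q.2)]
      congr 2 <;> abel
  have wsub (y : X) : Tendsto (fun q : ℕ × ℕ => symNorm y (x q.1 - x' q.2))
      ((U : Filter ℕ).curry U) (𝓝 (S' (-y) + S' y)) :=
    ((wS' (-y)).add (wS' y)).congr fun q => by
      unfold symNorm
      rw [← norm_neg (-y + -x q.1 + x' q.2)]
      congr 2 <;> abel
  have hadd' := hadd.congr fun q => by rw [add_comm]
  have hsub' := hsub.congr fun q => by rw [← tripNorm_neg, neg_sub]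
  have n0 : Tendsto (fun q : ℕ × ℕ => ‖x q.1‖) ((U : Filter ℕ).curry U) (𝓝 (A 0)) := by
    simpa using wA 0
  have n0' : Tendsto (fun q : ℕ × ℕ => ‖x' q.2‖) ((U : Filter ℕ).curry U) (𝓝 (B 0)) := by
    simpa using wB 0
  have n1 : Tendsto (fun q : ℕ × ℕ => ‖x q.1 + x' q.2‖) ((U : Filter ℕ).curry U) (𝓝 (S 0)) := by
    simpa using wS 0
  have n1' := n1.congr fun q => by rw [add_comm]
  have n2' : Tendsto (fun q : ℕ × ℕ => ‖x' q.2 - x q.1‖)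
      ((U : Filter ℕ).curry U) (𝓝 (S' 0)) :=
    (wS' 0).congr fun q => by rw [zero_add, neg_add_eq_sub]
  have n2 := n2'.congr fun q => by rw [norm_sub_rev]
  have b1 := add_le_two_mul_of_tendsto_norm hCd hp hsum hadd hsub (fun q => hx1 q.1) n0 n1 n2
  have b2 := add_le_two_mul_of_tendsto_norm hCd hp hsum hadd' hsub' (fun q => hx1' q.2)
    n0' n1' n2'
  have a1 := hSA 0
  have a2 := hSA' 0
  have a3 := hSB 0
  have a4 := hSB' 0
  rw [neg_zero] at a2
  rw [show S 0 = A 0 by linarith] at n1 n1'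
  rw [show S' 0 = A 0 by linarith] at n2 n2'
  rw [show B 0 = A 0 by linarith] at n0'
  have hL : 0 < A 0 := by
    set T := 2 * ∑' c : C, p (c : X) * (1 + ‖(c : X)‖)
    have hT (i : ℕ) : 1 ≤ T * ‖x i‖ := by rw [← hx1 i]; exact tripNorm_le hp hsum _
    have h1 : 1 ≤ T * A 0 := ge_of_tendsto' ((hA 0).const_mul T) fun i => by
      simpa using hT i
    have h0 : 0 ≤ A 0 := ge_of_tendsto' (hA 0) fun i => norm_nonneg _
    exact h0.lt_of_ne fun h => by rw [← h] at h1; norm_num at h1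
  have hkey (y : X) : A y = S y ∧ A (-y) = A y ∧ B y = A y := by
    have d1 := tendsto_nhds_unique (((wadd y).add (wsub y)).sub ((wAs y).const_mul 2))
      (tendsto_symNorm_defect hCd hp hsum hadd hsub (fun q => hx1 q.1) hL n0 n1 n2 y)
    have d2 := tendsto_nhds_unique (((wadd y).add (wsub y)).sub ((wBs y).const_mul 2))
      ((tendsto_symNorm_defect hCd hp hsum hadd' hsub' (fun q => hx1' q.2) hL n0' n1' n2' y).congr
        fun q => by
          have e : symNorm y (x' q.2 - x q.1) = symNorm y (x q.1 - x' q.2) := by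
            unfold symNorm
            rw [add_comm]
            congr 2 <;> abel
          rw [e, add_comm (x' q.2)])
    have := hSA y
    have := hSA (-y)
    have := hSA' y
    have h4 := hSA' (-y)
    rw [neg_neg] at h4
    have := hSB y
    have := hSB (-y)
    have := hSB' y
    have := hSB' (-y)
    refine ⟨?_, ?_, ?_⟩ <;> linarith
  have hAB (y : X) : B y = A y := (hkey y).2.2
  refine ⟨A, hA, fun y => ?_, fun y => (hkey y).2.1⟩
  rw [show A y = S y from (hkey y).1]
  simpa only [hAB] using hS y

end Stabilization

section Subsequence

/-- An even type invariant under translation by `x` yields a subsequence of `x` whose signed sums,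
hence all sums with coefficients in `[-1, 1]`, are bounded. -/
theorem exists_strictMono_norm_sum_le {x : ℕ → X} {U : Filter ℕ} [U.NeBot]
    (hU : U ≤ atTop) {A : X → ℝ} (hnorm : ∀ y, ‖y‖ ≤ A y)
    (hinv : ∀ y, Tendsto (fun i => A (y + x i)) U (𝓝 (A y))) (heven : ∀ y, A (-y) = A y) :
    ∃ k : ℕ → ℕ, StrictMono k ∧ ∀ (a : ℕ → ℝ), (∀ i, |a i| ≤ 1) → ∀ n,
      ‖∑ i ∈ Finset.range n, a i • x (k i)‖ ≤ A 0 + 1 := by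
  have hinv' (y : X) : Tendsto (fun i => A (y - x i)) U (𝓝 (A y)) := by
    rw [← heven y]
    exact (hinv (-y)).congr fun i => by rw [← heven]; congr 1; abel
  let State := {s : Set X × ℕ // s.1.Finite ∧ ∀ y ∈ s.1, A y < A 0 + 1}
  have step (s : State) : ∃ k, s.1.2 < k ∧
      ∀ y ∈ s.1.1, A (y + x k) < A 0 + 1 ∧ A (y - x k) < A 0 + 1 := by
    obtain ⟨⟨Y, m⟩, hfin, hY⟩ := s
    refine ((Filter.Eventually.filter_mono hU (eventually_gt_atTop m)).and
      ((Filter.eventually_all_finite hfin).2 fun y hy => ?_)).exists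
    exact ((hinv y).eventually_lt_const (hY y hy)).and ((hinv' y).eventually_lt_const (hY y hy))
  choose k hk hkY using step
  let next (s : State) : State :=
    ⟨((fun y => y + x (k s)) '' s.1.1 ∪ (fun y => y - x (k s)) '' s.1.1, k s),
      (s.2.1.image _).union (s.2.1.image _), by
        rintro _ (⟨y, hy, rfl⟩ | ⟨y, hy, rfl⟩)
        · exact (hkY s y hy).1
        · exact (hkY s y hy).2⟩
  let start : State := ⟨({0}, 0), Set.finite_singleton 0, by simp⟩
  let state (n : ℕ) : State := next^[n] start
  have hstate (n : ℕ) : state (n + 1) = next (state n) := Function.iterate_succ_apply' _ _ _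
  refine ⟨fun n => k (state n), strictMono_nat_of_lt_succ fun n => ?_, fun a ha n => ?_⟩
  · have := hk (state (n + 1))
    rwa [show (state (n + 1)).1.2 = k (state n) by rw [hstate]] at this
  have hmem (n : ℕ) : ∑ i ∈ Finset.range n, a i • x (k (state i)) ∈
      convexHull ℝ (state n).1.1 := by
    induction n with
    | zero => exact subset_convexHull ℝ _ (by simp [state, start])
    | succ n ih =>
      rw [Finset.sum_range_succ]
      set w := x (k (state n)) with hw
      set H := convexHull ℝ (state (n + 1)).1.1 with hH
      have hHc : Convex ℝ H := convex_convexHull ℝ _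
      have hplus : convexHull ℝ (state n).1.1 ⊆ (fun y => y + w) ⁻¹' H :=
        convexHull_min (fun y hy => subset_convexHull ℝ _ (by
          rw [hstate]; exact Or.inl ⟨y, hy, rfl⟩)) (hHc.translate_preimage_left w)
      have hminus : convexHull ℝ (state n).1.1 ⊆ (fun y => y + -w) ⁻¹' H :=
        convexHull_min (fun y hy => subset_convexHull ℝ _ (by
          rw [hstate]; exact Or.inr ⟨y, hy, sub_eq_add_neg y w⟩)) (hHc.translate_preimage_left (-w))
      have hc := hHc (hplus ih) (hminus ih) (a := (1 + a n) / 2) (b := (1 - a n) / 2)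
        (by linarith [(abs_le.1 (ha n)).1]) (by linarith [(abs_le.1 (ha n)).2]) (by ring)
      convert hc using 1
      module
  have hball : convexHull ℝ (state n).1.1 ⊆ Metric.closedBall 0 (A 0 + 1) :=
    convexHull_min (fun y hy => by
      rw [mem_closedBall_zero_iff]
      exact (hnorm y).trans ((state n).2.2 y hy).le) (convex_closedBall _ _)
  exact mem_closedBall_zero_iff.1 (hball (hmem n))

theorem sum_range_extend_smul {k : ℕ → ℕ} (hk : StrictMono k) (x : ℕ → X) (a : ℕ → ℝ) (n : ℕ) :
    ∑ l ∈ Finset.range (k n), Function.extend k a 0 l • x l =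
      ∑ i ∈ Finset.range n, a i • x (k i) := by
  have h : ∑ l ∈ (Finset.range n).image k, Function.extend k a 0 l • x l =
      ∑ i ∈ Finset.range n, a i • x (k i) := by
    rw [Finset.sum_image hk.injective.injOn]
    exact Finset.sum_congr rfl fun i _ => by rw [hk.injective.extend_apply]
  rw [← h]
  refine (Finset.sum_subset (fun l hl => ?_) fun l hl hl' => ?_).symm
  · obtain ⟨i, hi, rfl⟩ := Finset.mem_image.1 hl
    exact Finset.mem_range.2 (hk (Finset.mem_range.1 hi))
  · rw [Function.extend_apply', Pi.zero_apply, zero_smul]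
    rintro ⟨i, rfl⟩
    exact hl' (Finset.mem_image_of_mem k (Finset.mem_range.2
      (hk.lt_iff_lt.1 (Finset.mem_range.1 hl))))

theorem IsCBasicW.subsequence {ν : X → ℝ} {K : ℝ} {x : ℕ → X} (hx : IsCBasicW ν K x)
    {k : ℕ → ℕ} (hk : StrictMono k) : IsCBasicW ν K fun i => x (k i) := by
  refine ⟨fun i => hx.1 _, fun n m hnm a => ?_⟩
  have h := hx.2 (k n) (k m) (hk hnm) (Function.extend k a 0)
  rwa [sum_range_extend_smul hk, sum_range_extend_smul hk] at h

theorem IsCBasicW.exists_norm_sum_le {ν : X → ℝ} {K α β : ℝ} {x : ℕ → X} (hx : IsCBasicW ν K x)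
    (hα : 0 < α) (hβ : 0 ≤ β) (hlow : ∀ z, α * ‖z‖ ≤ ν z) (hup : ∀ z, ν z ≤ β * ‖z‖) :
    ∃ D, 0 < D ∧ ∀ n m : ℕ, n ≤ m → ∀ a : ℕ → ℝ,
      ‖∑ i ∈ Finset.range n, a i • x i‖ ≤ D * ‖∑ i ∈ Finset.range m, a i • x i‖ := by
  refine ⟨|K| * β / α + 1, by positivity, fun n m hnm a => ?_⟩
  set z := ∑ i ∈ Finset.range m, a i • x i with hz
  have hpos : 0 ≤ |K| * β / α * ‖z‖ := by positivity
  rcases hnm.eq_or_lt with rfl | hlt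
  · linarith
  have hν : 0 ≤ ν z := le_trans (by positivity) (hlow z)
  have h : α * ‖∑ i ∈ Finset.range n, a i • x i‖ ≤ |K| * β * ‖z‖ := calc
    _ ≤ K * ν z := (hlow _).trans (hx.2 n m hlt a)
    _ ≤ |K| * ν z := mul_le_mul_of_nonneg_right (le_abs_self K) hν
    _ ≤ |K| * (β * ‖z‖) := mul_le_mul_of_nonneg_left (hup z) (abs_nonneg K)
    _ = _ := by ring
  have h' : ‖∑ i ∈ Finset.range n, a i • x i‖ ≤ |K| * β / α * ‖z‖ := by
    rw [div_mul_eq_mul_div, le_div_iff₀ hα]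
    linarith
  linarith [norm_nonneg z]

/-- A seminormalized basic sequence dominated by the basis of `c₀` is equivalent to it. -/
theorem exists_c0_equivalence {u : ℕ → X} {D M δ : ℝ} (hD : 0 < D) (hM : 0 < M) (hδ : 0 < δ)
    (hu : ∀ i, δ ≤ ‖u i‖)
    (hbasic : ∀ n m : ℕ, n ≤ m → ∀ a : ℕ → ℝ,
      ‖∑ i ∈ Finset.range n, a i • u i‖ ≤ D * ‖∑ i ∈ Finset.range m, a i • u i‖)
    (hbdd : ∀ a : ℕ → ℝ, (∀ i, |a i| ≤ 1) → ∀ n, ‖∑ i ∈ Finset.range n, a i • u i‖ ≤ M) :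
    ∃ A B : ℝ, 0 < A ∧ 0 < B ∧ ∀ (n : ℕ) (a : ℕ → ℝ),
      A⁻¹ * (⨆ i ∈ Finset.range n, |a i|) ≤ ‖∑ i ∈ Finset.range n, a i • u i‖ ∧
        ‖∑ i ∈ Finset.range n, a i • u i‖ ≤ B * ⨆ i ∈ Finset.range n, |a i| := by
  refine ⟨2 * D / δ, M, by positivity, hM, fun n a => ⟨?_, ?_⟩⟩
  · rw [inv_mul_le_iff₀ (by positivity)]
    refine biSup_abs_le a (by positivity) fun i hi => ?_
    have h1 := hbasic i n hi.le a
    have h2 := hbasic (i + 1) n hi a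
    have h3 := norm_sub_le (∑ j ∈ Finset.range (i + 1), a j • u j)
      (∑ j ∈ Finset.range i, a j • u j)
    rw [Finset.sum_range_succ_sub_sum, norm_smul, Real.norm_eq_abs] at h3
    have h4 := mul_le_mul_of_nonneg_left (hu i) (abs_nonneg (a i))
    rw [div_mul_eq_mul_div, le_div_iff₀ hδ]
    linarith
  · set s := ⨆ i ∈ Finset.range n, |a i| with hs
    have hs0 : 0 ≤ s := biSup_abs_nonneg n a
    rcases hs0.eq_or_lt with h0 | h0
    · have : ∑ i ∈ Finset.range n, a i • u i = 0 := Finset.sum_eq_zero fun i hi => by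
        have := abs_le_biSup_abs a (Finset.mem_range.1 hi)
        rw [← hs, ← h0] at this
        rw [abs_nonpos_iff.1 this, zero_smul]
      rw [this, norm_zero, ← h0, mul_zero]
    · set b : ℕ → ℝ := fun i => if i < n then a i / s else 0 with hb
      have hb1 (i : ℕ) : |b i| ≤ 1 := by
        simp only [hb]
        split_ifs with hi
        · rw [abs_div, abs_of_pos h0, div_le_one h0]
          exact abs_le_biSup_abs a hi
        · simp
      have e : ∑ i ∈ Finset.range n, a i • u i = s • ∑ i ∈ Finset.range n, b i • u i := by
        rw [Finset.smul_sum]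
        refine Finset.sum_congr rfl fun i hi => ?_
        simp only [hb, if_pos (Finset.mem_range.1 hi), smul_smul]
        rw [mul_div_cancel₀ _ h0.ne']
      rw [e, norm_smul, Real.norm_of_nonneg hs0, mul_comm]
      exact mul_le_mul_of_nonneg_right (hbdd b hb1 n) hs0

end Subsequence

/-- Theorem 4.2: if the asymptotic norm `|||·||| = tripNorm C p` admits a weakly null basic
array generating (in `(X, |||·|||)`) an asymptotic model 1-equivalent to the unit vector
basis of `c₀` (i.e. with limit norms `max_{i<n} |b i|`), then `X` contains an isomorphic
copy of `c₀` (a sequence equivalent to the unit vector basis of `c₀`). -/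
theorem stmt_14 {X : Type*} [NormedAddCommGroup X] [NormedSpace ℝ X] [CompleteSpace X]
    [TopologicalSpace.SeparableSpace X] (hinf : ¬ FiniteDimensional ℝ X)
    (C : Set X) (hCc : C.Countable) (hCd : Dense C)
    (p : X → ℝ) (hp : ∀ c ∈ C, 0 < p c)
    (hsum : Summable fun c : C => p (c : X) * (1 + ‖(c : X)‖))
    (harr : ∃ x : ℕ → ℕ → X, IsBasicArrayW (tripNorm C p) x ∧ (∀ n, WeaklyNull (x n)) ∧
      ∀ (n : ℕ) (b : ℕ → ℝ),
        IteratedLimit n (fun t => tripNorm C p (∑ j : Fin n, b (j : ℕ) • x (j : ℕ) (t j)))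
          (⨆ i ∈ Finset.range n, |b i|)) :
    ∃ u : ℕ → X, ∃ A B : ℝ, 0 < A ∧ 0 < B ∧ ∀ (n : ℕ) (a : ℕ → ℝ),
      A⁻¹ * (⨆ i ∈ Finset.range n, |a i|) ≤ ‖∑ i ∈ Finset.range n, a i • u i‖ ∧
        ‖∑ i ∈ Finset.range n, a i • u i‖ ≤ B * ⨆ i ∈ Finset.range n, |a i| := by
  obtain ⟨x, ⟨K, hK, -⟩, hnull, hlim⟩ := harr
  have : Nontrivial X := by
    by_contra h
    rw [not_nontrivial_iff_subsingleton] at h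
    exact hinf inferInstance
  have hU : (hyperfilter ℕ : Filter ℕ) ≤ atTop := by
    rw [← Nat.cofinite_eq_atTop]
    exact hyperfilter_le_cofinite
  have hpair {b : ℕ → ℝ} (hb : ∀ i, |b i| = 1) :
      Tendsto (fun q : ℕ × ℕ => tripNorm C p (b 0 • x 0 q.1 + b 1 • x 1 q.2))
        ((hyperfilter ℕ : Filter ℕ).curry (hyperfilter ℕ)) (𝓝 1) := by
    have h1 : (⨆ i ∈ Finset.range 2, |b i|) = 1 :=
      le_antisymm (biSup_abs_le b zero_le_one fun i _ => (hb i).le)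
        ((hb 0).ge.trans (abs_le_biSup_abs b two_pos))
    have h2 := (hlim 2 b).tendsto_curry hU
    rw [h1] at h2
    simpa [Fin.sum_univ_two] using h2
  obtain ⟨A, hA, hinv, heven⟩ := exists_invariant_type hCd hp hsum (hnull 0) (hnull 1)
    (hK 0).1 (hK 1).1 hU (by simpa using hpair (b := fun _ => 1) (by simp))
    (by simpa [sub_eq_add_neg] using
      hpair (b := fun i => if i = 0 then 1 else -1) (fun i => by split_ifs <;> simp))
  have hnorm (y : X) : ‖y‖ ≤ A y := le_of_tendsto_norm_add_of_weaklyNull (hnull 0) hU (hA y)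
  obtain ⟨k, hk, hbdd⟩ := exists_strictMono_norm_sum_le hU hnorm hinv heven
  obtain ⟨c, hc⟩ := hCd.nonempty
  set β := 2 * ∑' c : C, p (c : X) * (1 + ‖(c : X)‖) with hβ
  have hup (z : X) : tripNorm C p z ≤ β * ‖z‖ := tripNorm_le hp hsum z
  have hβ0 : 0 < β := by
    have h := (hK 0).1 0 ▸ hup (x 0 0)
    by_contra! hneg
    linarith [mul_nonpos_of_nonpos_of_nonneg hneg (norm_nonneg (x 0 0))]
  obtain ⟨D, hD, hbasic⟩ := ((hK 0).2.subsequence hk).exists_norm_sum_le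
    (by linarith [hp c hc] : 0 < 2 * p c) hβ0.le (mul_norm_le_tripNorm hp hsum hc) hup
  refine ⟨fun i => x 0 (k i), exists_c0_equivalence hD (M := A 0 + 1) ?_
    (inv_pos.2 hβ0) (fun i => ?_) hbasic hbdd⟩
  · linarith [hnorm 0, norm_nonneg (0 : X)]
  · rw [inv_le_iff_one_le_mul₀' hβ0, ← (hK 0).1 (k i)]
    exact hup _
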